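/- (Corollary 5.12(i)) Consider ℓ²(ℤ₊×ℤ₊) with the counting measure and the 2-variable weighted shift pair determined by positive double sequences α = (α_{(n,m)}) and β = (β_{(n,m)}): W₁e_{(n,m)} = α_{(n,m)}·e_{(n+1,m)} and W₂e_{(n,m)} = β_{(n,m)}·e_{(n,m+1)}. With the conventions α_{(-1,m)} = 0 and β_{(n,-1)} = 0, set H(n,m) := α_{(n,m)}² + β_{(n,m)}² and K(n,m) := α_{(n-1,m)}² + β_{(n,m-1)}². Then for every p ∈ (0,1], the pair (W₁,W₂) is spherically p-hyponormal — i.e. Σ_{(n,m)} K(n,m)^p·|f(n,m)|² ≤ Σ_{(n,m)} H(n,m)^p·|f(n,m)|² for every f ∈ ℓ²(ℤ₊×ℤ₊) — if and only if α_{(n-1,m)}² + β_{(n,m-1)}² ≤ α_{(n,m)}² + β_{(n,m)}² for all (n,m) ∈ ℤ₊×ℤ₊. -/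

import Mathlib

open scoped ENNReal NNReal

/-- **Corollary 5.12(i)**: for the 2-variable weighted shift on `ℓ²(ℤ₊×ℤ₊)` with
positive weights `α`, `β`, setting `H(n,m) := α(n,m)² + β(n,m)²` and
`K(n,m) := α(n-1,m)² + β(n,m-1)²` (with the conventions `α(-1,m) = β(n,-1) = 0`),
the pair is spherically `p`-hyponormal for `p ∈ (0,1]` — i.e.
`Σ K^p·|f|² ≤ Σ H^p·|f|²` for every `f ∈ ℓ²` — iff
`α(n-1,m)² + β(n,m-1)² ≤ α(n,m)² + β(n,m)²` for all `(n,m)`. -/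
theorem stmt_19
    (α β : ℕ × ℕ → ℝ)
    (hα : ∀ q, 0 < α q) (hβ : ∀ q, 0 < β q)
    (p : ℝ) (hp0 : 0 < p) (hp1 : p ≤ 1) :
    (∀ f : ℕ × ℕ → ℂ, (∑' q : ℕ × ℕ, (‖f q‖₊ : ℝ≥0∞) ^ 2) < ⊤ →
      ∑' q : ℕ × ℕ,
          ENNReal.ofReal
            (((if q.1 = 0 then 0 else α (q.1 - 1, q.2) ^ 2) +
              (if q.2 = 0 then 0 else β (q.1, q.2 - 1) ^ 2)) ^ p) *
            (‖f q‖₊ : ℝ≥0∞) ^ 2 ≤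
        ∑' q : ℕ × ℕ,
          ENNReal.ofReal ((α q ^ 2 + β q ^ 2) ^ p) * (‖f q‖₊ : ℝ≥0∞) ^ 2) ↔
    (∀ q : ℕ × ℕ,
      (if q.1 = 0 then 0 else α (q.1 - 1, q.2) ^ 2) +
        (if q.2 = 0 then 0 else β (q.1, q.2 - 1) ^ 2) ≤ α q ^ 2 + β q ^ 2) := by
  have hK : ∀ q : ℕ × ℕ, 0 ≤ (if q.1 = 0 then 0 else α (q.1 - 1, q.2) ^ 2) +
        (if q.2 = 0 then 0 else β (q.1, q.2 - 1) ^ 2) := by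
    intro q
    split_ifs <;> positivity
  have hH : ∀ q : ℕ × ℕ, 0 ≤ α q ^ 2 + β q ^ 2 := fun q => by positivity
  have key : ∀ (K H : ℕ × ℕ → ℝ), (∀ q, 0 ≤ K q) → (∀ q, 0 ≤ H q) →
      ((∀ f : ℕ × ℕ → ℂ, (∑' q : ℕ × ℕ, (‖f q‖₊ : ℝ≥0∞) ^ 2) < ⊤ →
        ∑' q : ℕ × ℕ, ENNReal.ofReal (K q ^ p) * (‖f q‖₊ : ℝ≥0∞) ^ 2 ≤
        ∑' q : ℕ × ℕ, ENNReal.ofReal (H q ^ p) * (‖f q‖₊ : ℝ≥0∞) ^ 2) ↔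
      ∀ q, K q ≤ H q) := by
    intro K H hK hH
    constructor
    · intro h q
      have hs : ∀ G : ℕ × ℕ → ℝ≥0∞,
          ∑' r : ℕ × ℕ, G r * (‖(Pi.single q 1 : ℕ × ℕ → ℂ) r‖₊ : ℝ≥0∞) ^ 2 = G q := by
        intro G
        rw [tsum_eq_single q]
        · simp
        · intro r hr
          simp [Pi.single_eq_of_ne hr]
      have h1 := h (Pi.single q 1) (by
        have := hs (fun _ => 1)
        simp only [one_mul] at this
        rw [this]
        exact ENNReal.one_lt_top)
      rw [hs (fun q => ENNReal.ofReal (K q ^ p)), hs (fun q => ENNReal.ofReal (H q ^ p)),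
        ENNReal.ofReal_le_ofReal_iff (Real.rpow_nonneg (hH q) p)] at h1
      exact (Real.rpow_le_rpow_iff (hK q) (hH q) hp0).1 h1
    · intro h f _
      refine ENNReal.tsum_le_tsum fun q => ?_
      gcongr
      · exact hK q
      · exact h q
  exact key _ _ hK hH
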